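/- Let λ be a Lévy measure on (0,∞) satisfying Condition (F) and ∫_{(1,∞)} (log z)^{d/2} λ(dz) < ∞, and let A ⊆ ℝ^d be a bounded Borel set whose closure has positive Lebesgue measure |Ā| > 0. If either m_{2/d}(λ) = ∫_{(0,∞)} z^{2/d} λ(dz) < ∞, or λ̄(r) = ℓ(r) r^{−2/d} for all r ≥ 1 with ℓ slowly varying and ∫_1^∞ ℓ(u) u^{-1} du = ∞, then η̄_A(r) ~ |Ā| · τ̄(r) as r → ∞. -/

import Mathlib

open MeasureTheory Real Filter Set
open scoped ENNReal Topology

noncomputable section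

/-- The heat kernel on `ℝ^d` with diffusion constant `κ`. -/
def heatKernel (d : ℕ) (κ : ℝ) (s : ℝ) (x : EuclideanSpace ℝ (Fin d)) : ℝ :=
  (2 * π * κ * s) ^ (-(d : ℝ) / 2) * Real.exp (-‖x‖ ^ 2 / (2 * κ * s))

/-- A Lévy measure on `(0,∞)`: a nonzero Borel measure carried by `(0,∞)`
with `∫ min(1, z²) λ(dz) < ∞`. -/
def IsLevyMeasure (lam : Measure ℝ) : Prop :=
  lam ≠ 0 ∧ lam (Set.Iic 0) = 0 ∧
    ∫⁻ z in Set.Ioi (0 : ℝ), ENNReal.ofReal (min 1 (z ^ 2)) ∂lam < ⊤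

/-- `η̄(r) = (Leb ⊗ Leb ⊗ λ)({(s,y,z) ∈ (0,t] × ℝ^d × (0,∞) : g(s,y) z > r})`. -/
def etaBar (d : ℕ) (κ t : ℝ) (lam : Measure ℝ) (r : ℝ) : ℝ≥0∞ :=
  (volume.prod (volume.prod lam))
    {p : ℝ × (EuclideanSpace ℝ (Fin d)) × ℝ |
      p.1 ∈ Set.Ioc (0 : ℝ) t ∧ p.2.2 ∈ Set.Ioi (0 : ℝ) ∧
        r < heatKernel d κ p.1 p.2.1 * p.2.2}

/-- `η̄₀(r)`, the analogue of `η̄` with the restriction `|y| ≤ 1/2`. -/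
def etaBar0 (d : ℕ) (κ t : ℝ) (lam : Measure ℝ) (r : ℝ) : ℝ≥0∞ :=
  (volume.prod (volume.prod lam))
    {p : ℝ × (EuclideanSpace ℝ (Fin d)) × ℝ |
      p.1 ∈ Set.Ioc (0 : ℝ) t ∧ p.2.2 ∈ Set.Ioi (0 : ℝ) ∧ ‖p.2.1‖ ≤ 1 / 2 ∧
        r < heatKernel d κ p.1 p.2.1 * p.2.2}

/-- `η̄_A(r)`, where the heat kernel is evaluated at `dist(y, A)`. -/
def etaBarA (d : ℕ) (κ t : ℝ) (lam : Measure ℝ)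
    (A : Set (EuclideanSpace ℝ (Fin d))) (r : ℝ) : ℝ≥0∞ :=
  (volume.prod (volume.prod lam))
    {p : ℝ × (EuclideanSpace ℝ (Fin d)) × ℝ |
      p.1 ∈ Set.Ioc (0 : ℝ) t ∧ p.2.2 ∈ Set.Ioi (0 : ℝ) ∧
        r < (2 * π * κ * p.1) ^ (-(d : ℝ) / 2) *
            Real.exp (-(Metric.infDist p.2.1 A) ^ 2 / (2 * κ * p.1)) * p.2.2}

/-- `τ̄(r) = (Leb ⊗ λ)({(s,z) ∈ (0,t] × (0,∞) : (2πκs)^{-d/2} z > r})`. -/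
def tauBar (d : ℕ) (κ t : ℝ) (lam : Measure ℝ) (r : ℝ) : ℝ≥0∞ :=
  (volume.prod lam)
    {p : ℝ × ℝ | p.1 ∈ Set.Ioc (0 : ℝ) t ∧ p.2 ∈ Set.Ioi (0 : ℝ) ∧
      r < (2 * π * κ * p.1) ^ (-(d : ℝ) / 2) * p.2}

/-- The truncated moment `M_γ(x) = ∫_{(0,x]} z^γ λ(dz)`. -/
def Mgamma (lam : Measure ℝ) (γ x : ℝ) : ℝ≥0∞ :=
  ∫⁻ z in Set.Ioc (0 : ℝ) x, ENNReal.ofReal (z ^ γ) ∂lam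

/-- A measurable function, positive on `[1,∞)`, is slowly varying at infinity if
`ℓ(cx)/ℓ(x) → 1` as `x → ∞` for every `c > 0`. -/
def SlowlyVarying (ℓ : ℝ → ℝ) : Prop :=
  Measurable ℓ ∧ (∀ x ≥ (1 : ℝ), 0 < ℓ x) ∧
    ∀ c > (0 : ℝ), Tendsto (fun x => ℓ (c * x) / ℓ x) atTop (𝓝 1)

/-- Regular variation at infinity with index `-α`: `f` is eventually positive and
`f(cr)/f(r) → c^{-α}` as `r → ∞` for every `c > 0`. -/
def RegVaryNeg (f : ℝ → ℝ) (α : ℝ) : Prop :=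
  (∀ᶠ r in atTop, 0 < f r) ∧
    ∀ c > (0 : ℝ), Tendsto (fun r => f (c * r) / f r) atTop (𝓝 (c ^ (-α)))

/-- Condition (E): the necessary and sufficient condition for existence of the solution. -/
def ConditionE (d : ℕ) (lam : Measure ℝ) : Prop :=
  (∫⁻ z in Set.Ioi (1 : ℝ), ENNReal.ofReal (Real.log z ^ ((d : ℝ) / 2)) ∂lam < ⊤) ∧
  (d = 1 → ∫⁻ z in Set.Ioc (0 : ℝ) 1, ENNReal.ofReal (z ^ 2) ∂lam < ⊤) ∧
  (d = 2 → ∫⁻ z in Set.Ioc (0 : ℝ) 1, ENNReal.ofReal (z ^ 2 * |Real.log z|) ∂lam < ⊤) ∧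
  (3 ≤ d → ∫⁻ z in Set.Ioc (0 : ℝ) 1, ENNReal.ofReal (z ^ (1 + 2 / (d : ℝ))) ∂lam < ⊤)

/-- Condition (F): `∫_{(0,1)} z^{2/d} λ(dz) < ∞` if `d ≠ 2`,
and `∫_{(0,1)} z |log z| λ(dz) < ∞` if `d = 2`. -/
def ConditionF (d : ℕ) (lam : Measure ℝ) : Prop :=
  (d ≠ 2 → ∫⁻ z in Set.Ioo (0 : ℝ) 1, ENNReal.ofReal (z ^ ((2 : ℝ) / d)) ∂lam < ⊤) ∧
  (d = 2 → ∫⁻ z in Set.Ioo (0 : ℝ) 1, ENNReal.ofReal (z * |Real.log z|) ∂lam < ⊤)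

theorem IsLevyMeasure.measure_Ici_lt_top {lam : Measure ℝ} (h : IsLevyMeasure lam) {a : ℝ}
    (ha : 0 < a) : lam (Ici a) < ⊤ := by
  obtain ⟨-, -, hfin⟩ := h
  have hc : 0 < min 1 (a ^ 2) := by positivity
  have key : ENNReal.ofReal (min 1 (a ^ 2)) * lam (Ici a)
      ≤ ∫⁻ z in Set.Ioi (0 : ℝ), ENNReal.ofReal (min 1 (z ^ 2)) ∂lam := by
    rw [← setLIntegral_const]
    refine (setLIntegral_mono' measurableSet_Ici fun z hz => ?_).trans
      (lintegral_mono_set fun z hz => ha.trans_le hz)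
    have : a ^ 2 ≤ z ^ 2 := pow_le_pow_left₀ ha.le hz 2
    gcongr
  by_contra hcon
  rw [not_lt_top_iff.mp hcon, ENNReal.mul_top (ENNReal.ofReal_pos.mpr hc).ne'] at key
  exact hfin.not_ge key

theorem IsLevyMeasure.sigmaFinite {lam : Measure ℝ} (h : IsLevyMeasure lam) :
    SigmaFinite lam := by
  refine Measure.sigmaFinite_of_countable
    (S := insert (Iic 0) (range fun n : ℕ => Ici (1 / ((n : ℝ) + 1))))
    ((countable_range _).insert _) ?_ ?_
  · rintro s (rfl | ⟨n, rfl⟩)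
    · simp [h.2.1]
    · exact h.measure_Ici_lt_top (by positivity)
  · refine eq_univ_of_forall fun x => ?_
    rcases le_or_gt x 0 with hx | hx
    · exact ⟨_, Or.inl rfl, hx⟩
    · obtain ⟨n, hn⟩ := exists_nat_one_div_lt hx
      exact ⟨_, Or.inr ⟨n, rfl⟩, hn.le⟩

theorem ConditionF.lintegral_rpow_lt_top {d : ℕ} {lam : Measure ℝ} (hF : ConditionF d lam) :
    ∫⁻ z in Ioo (0 : ℝ) (Real.exp (-1)), ENNReal.ofReal (z ^ ((2 : ℝ) / d)) ∂lam < ⊤ := by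
  have hsub : Ioo (0 : ℝ) (Real.exp (-1)) ⊆ Ioo 0 1 :=
    Ioo_subset_Ioo_right (by simp)
  by_cases hd : d = 2
  · refine lt_of_le_of_lt ?_ (hF.2 hd)
    refine (setLIntegral_mono' measurableSet_Ioo fun z hz => ?_).trans (lintegral_mono_set hsub)
    subst hd
    have h1 : Real.log z ≤ -1 := by
      rw [← Real.log_exp (-1)]
      exact Real.log_le_log hz.1 hz.2.le
    have h2 : 1 ≤ |Real.log z| := by
      rw [abs_of_nonpos (by linarith)]; linarith
    apply ENNReal.ofReal_le_ofReal
    have : ((2 : ℝ) / ((2 : ℕ) : ℝ)) = 1 := by norm_num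
    rw [this, Real.rpow_one]
    nlinarith [hz.1]
  · exact (lintegral_mono_set hsub).trans_lt (hF.1 hd)

/-- The set of `(s, z)` whose measure is `tauBar`. -/
def tauSet (d : ℕ) (κ t r : ℝ) : Set (ℝ × ℝ) :=
  {p : ℝ × ℝ | p.1 ∈ Set.Ioc (0 : ℝ) t ∧ p.2 ∈ Set.Ioi (0 : ℝ) ∧
      r < (2 * π * κ * p.1) ^ (-(d : ℝ) / 2) * p.2}

theorem measurableSet_tauSet (d : ℕ) (κ t r : ℝ) : MeasurableSet (tauSet d κ t r) := by
  unfold tauSet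
  refine (measurable_fst measurableSet_Ioc).inter ((measurable_snd measurableSet_Ioi).inter ?_)
  exact measurableSet_lt measurable_const
    (show Measurable fun p : ℝ × ℝ => (2 * π * κ * p.1) ^ (-(d : ℝ) / 2) * p.2 by fun_prop)

theorem lt_rpow_neg_mul_iff {d : ℕ} (hd : 1 ≤ d) {x z r : ℝ} (hx : 0 < x) (hz : 0 < z)
    (hr : 0 < r) : r < x ^ (-(d : ℝ) / 2) * z ↔ x < (z / r) ^ ((2 : ℝ) / d) := by
  have hd0 : (0 : ℝ) < d := by exact_mod_cast hd
  have h1 : x < (z / r) ^ ((2 : ℝ) / d) ↔ x ^ ((d : ℝ) / 2) < z / r := by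
    rw [show (2 : ℝ) / d = ((d : ℝ) / 2)⁻¹ by rw [inv_div],
      Real.lt_rpow_inv_iff_of_pos hx.le (by positivity) (by positivity)]
  rw [h1, neg_div, Real.rpow_neg hx.le, lt_div_iff₀ hr, inv_mul_eq_div, lt_div_iff₀ (by positivity),
    mul_comm]

theorem mem_tauSet_iff {d : ℕ} (hd : 1 ≤ d) {κ t r : ℝ} (hκ : 0 < κ) (hr : 0 < r) (s z : ℝ) :
    (s, z) ∈ tauSet d κ t r ↔
      s ∈ Ioc 0 t ∧ 0 < z ∧ 2 * π * κ * s < (z / r) ^ ((2 : ℝ) / d) := by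
  unfold tauSet
  refine and_congr_right fun hs => and_congr_right fun hz => ?_
  exact lt_rpow_neg_mul_iff hd (by have := hs.1; positivity) hz hr

theorem volume_prod_regionUnder (lam : Measure ℝ) [SFinite lam] {f : ℝ → ℝ}
    (hf : Measurable f) {S : Set ℝ} (hS : MeasurableSet S) :
    (volume.prod lam) {p : ℝ × ℝ | p.2 ∈ S ∧ p.1 ∈ Ioo 0 (f p.2)}
      = ∫⁻ z in S, ENNReal.ofReal (f z) ∂lam := by
  have hm : MeasurableSet {p : ℝ × ℝ | p.2 ∈ S ∧ p.1 ∈ Ioo 0 (f p.2)} := by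
    refine (measurable_snd hS).inter ((measurableSet_lt measurable_const measurable_fst).inter
      (measurableSet_lt measurable_fst (by fun_prop)))
  rw [Measure.prod_apply_symm hm, ← lintegral_indicator hS]
  congr 1 with z
  by_cases hz : z ∈ S
  · rw [indicator_of_mem hz]
    have : (fun x : ℝ => (x, z)) ⁻¹' {p : ℝ × ℝ | p.2 ∈ S ∧ p.1 ∈ Ioo 0 (f p.2)} = Ioo 0 (f z) := by
      ext x; simp [hz]
    rw [this, Real.volume_Ioo, sub_zero]
  · rw [indicator_of_notMem hz]
    have : (fun x : ℝ => (x, z)) ⁻¹' {p : ℝ × ℝ | p.2 ∈ S ∧ p.1 ∈ Ioo 0 (f p.2)} = ∅ := by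
      ext x; simp [hz]
    rw [this, measure_empty]

theorem le_tauBar {d : ℕ} (hd : 1 ≤ d) {κ t r : ℝ} (hκ : 0 < κ) (hr : 0 < r)
    (lam : Measure ℝ) [SFinite lam] :
    ENNReal.ofReal (min t (1 / (2 * π * κ))) *
        ∫⁻ z in Ioc 0 r, ENNReal.ofReal ((z / r) ^ ((2 : ℝ) / d)) ∂lam
      ≤ tauBar d κ t lam r := by
  set c := min t (1 / (2 * π * κ)) with hc
  rcases le_or_gt c 0 with hc0 | hc0
  · simp [ENNReal.ofReal_of_nonpos hc0]
  have hp : (0 : ℝ) ≤ 2 / d := by positivity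
  rw [← lintegral_const_mul _ (by fun_prop)]
  simp_rw [← ENNReal.ofReal_mul hc0.le]
  rw [← volume_prod_regionUnder lam (by fun_prop) measurableSet_Ioc]
  change _ ≤ (volume.prod lam) (tauSet d κ t r)
  refine measure_mono ?_
  rintro ⟨s, z⟩ ⟨⟨hz0, hzr⟩, hs0, hs⟩
  simp only at hz0 hzr hs0 hs
  rw [mem_tauSet_iff hd hκ hr]
  have hu1 : (z / r) ^ ((2 : ℝ) / d) ≤ 1 :=
    Real.rpow_le_one (by positivity) ((div_le_one hr).mpr hzr) hp
  have hu0 : 0 < (z / r) ^ ((2 : ℝ) / d) := by positivity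
  refine ⟨⟨hs0, ?_⟩, hz0, ?_⟩
  · calc s ≤ c * (z / r) ^ ((2 : ℝ) / d) := hs.le
      _ ≤ c * 1 := by gcongr
      _ ≤ t := by rw [mul_one]; exact min_le_left _ _
  · have hD : 0 < 2 * π * κ := by positivity
    have : s < 1 / (2 * π * κ) * (z / r) ^ ((2 : ℝ) / d) :=
      hs.trans_le (mul_le_mul_of_nonneg_right (min_le_right _ _) hu0.le)
    rwa [one_div, inv_mul_eq_div, lt_div_iff₀ hD, mul_comm] at this

theorem tauBar_lt_top {d : ℕ} (hd : 1 ≤ d) {κ t r : ℝ} (hκ : 0 < κ) (hr : 0 < r)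
    {lam : Measure ℝ} (hlam : IsLevyMeasure lam) (hF : ConditionF d lam) :
    tauBar d κ t lam r < ⊤ := by
  have := hlam.sigmaFinite
  have hD : 0 < 2 * π * κ := by positivity
  set p : ℝ := 2 / d with hp
  have hsub : tauSet d κ t r ⊆
      {q : ℝ × ℝ | q.2 ∈ Ioo 0 (Real.exp (-1)) ∧
        q.1 ∈ Ioo 0 ((1 / r) ^ p / (2 * π * κ) * q.2 ^ p)}
      ∪ Ioc 0 t ×ˢ Ici (Real.exp (-1)) := by
    rintro ⟨s, z⟩ h
    rw [mem_tauSet_iff hd hκ hr] at h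
    obtain ⟨hs, hz, h⟩ := h
    rcases lt_or_ge z (Real.exp (-1)) with h1 | h1
    · refine Or.inl ⟨⟨hz, h1⟩, hs.1, ?_⟩
      have : (z / r) ^ p = (1 / r) ^ p * z ^ p := by
        rw [← Real.mul_rpow (by positivity) hz.le]; ring_nf
      simp only
      rw [div_mul_eq_mul_div, lt_div_iff₀ hD, ← this]
      linarith
    · exact Or.inr ⟨hs, h1⟩
  change (volume.prod lam) (tauSet d κ t r) < ⊤
  refine (measure_mono hsub).trans_lt ((measure_union_le _ _).trans_lt
    (ENNReal.add_lt_top.mpr ⟨?_, ?_⟩))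
  · rw [volume_prod_regionUnder lam (f := fun z => (1 / r) ^ p / (2 * π * κ) * z ^ p)
      (by fun_prop) measurableSet_Ioo]
    simp_rw [ENNReal.ofReal_mul (show 0 ≤ (1 / r) ^ p / (2 * π * κ) by positivity)]
    rw [lintegral_const_mul _ (by fun_prop)]
    exact ENNReal.mul_lt_top ENNReal.ofReal_lt_top hF.lintegral_rpow_lt_top
  · rw [Measure.prod_prod]
    exact ENNReal.mul_lt_top (by simp) (hlam.measure_Ici_lt_top (Real.exp_pos _))

theorem sq_le_of_lt_gaussian_mul {d : ℕ} (hd : 1 ≤ d) {κ s z r ρ a : ℝ} (hκ : 0 < κ)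
    (hs : 0 < s) (hz : 0 < z) (hr : 0 < r) (ha : 0 < a)
    (h : r < (2 * π * κ * s) ^ (-(d : ℝ) / 2) * Real.exp (-ρ ^ 2 / (2 * κ * s)) * z) :
    ρ ^ 2 ≤ κ * d / a * (s * ((z / r) ^ ((2 : ℝ) / d) / (2 * π * κ * s)) ^ a) := by
  have hd0 : (0 : ℝ) < d := by exact_mod_cast hd
  have hDs : 0 < 2 * π * κ * s := by positivity
  set x := (z / r) ^ ((2 : ℝ) / d) / (2 * π * κ * s) with hx
  have hx0 : 0 < x := by positivity
  have hlog : Real.log r < -(d : ℝ) / 2 * Real.log (2 * π * κ * s) + -ρ ^ 2 / (2 * κ * s)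
      + Real.log z := by
    have := Real.log_lt_log hr h
    rwa [Real.log_mul (by positivity) hz.ne', Real.log_mul (by positivity) (by positivity),
      Real.log_rpow hDs, Real.log_exp] at this
  have hlx : Real.log x = 2 / d * (Real.log z - Real.log r) - Real.log (2 * π * κ * s) := by
    rw [hx, Real.log_div (by positivity) hDs.ne', Real.log_rpow (by positivity),
      Real.log_div hz.ne' hr.ne']
  have hle : Real.log x ≤ x ^ a / a := Real.log_le_rpow_div hx0.le ha
  have h1 : ρ ^ 2 / (2 * κ * s) ≤ d / 2 * Real.log x := by
    rw [hlx]
    have : (d : ℝ) / 2 * (2 / d * (Real.log z - Real.log r) - Real.log (2 * π * κ * s))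
      = (Real.log z - Real.log r) - d / 2 * Real.log (2 * π * κ * s) := by field_simp
    rw [this]
    rw [neg_div, neg_div] at hlog
    linarith
  have h2 : ρ ^ 2 / (2 * κ * s) ≤ d / 2 * (x ^ a / a) := h1.trans (by gcongr)
  rw [div_le_iff₀ (by positivity)] at h2
  refine h2.trans (le_of_eq ?_)
  field_simp

/-- The set of `(s, y, z)` whose measure is `etaBarA`. -/
def etaSet (d : ℕ) (κ t : ℝ) (A : Set (EuclideanSpace ℝ (Fin d))) (r : ℝ) :
    Set (ℝ × (EuclideanSpace ℝ (Fin d)) × ℝ) :=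
  {p : ℝ × (EuclideanSpace ℝ (Fin d)) × ℝ |
      p.1 ∈ Set.Ioc (0 : ℝ) t ∧ p.2.2 ∈ Set.Ioi (0 : ℝ) ∧
        r < (2 * π * κ * p.1) ^ (-(d : ℝ) / 2) *
            Real.exp (-(Metric.infDist p.2.1 A) ^ 2 / (2 * κ * p.1)) * p.2.2}

/-- The cylinder over `T` in the middle variable ranging over `B`. -/
def midProd {Y : Type*} (B : Set Y) (T : Set (ℝ × ℝ)) : Set (ℝ × Y × ℝ) :=
  {p | p.2.1 ∈ B ∧ (p.1, p.2.2) ∈ T}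

theorem measure_midProd {Y : Type*} [MeasureSpace Y] [SFinite (volume : Measure Y)]
    (lam : Measure ℝ) [SFinite lam] {B : Set Y} {T : Set (ℝ × ℝ)}
    (hB : MeasurableSet B) (hT : MeasurableSet T) :
    ((volume : Measure ℝ).prod ((volume : Measure Y).prod lam)) (midProd B T)
      = volume B * (volume.prod lam) T := by
  have hm : MeasurableSet (midProd B T) :=
    (measurable_snd.fst hB).inter ((measurable_fst.prodMk measurable_snd.snd) hT)
  rw [Measure.prod_apply hm, Measure.prod_apply hT, ← lintegral_const_mul _
    (measurable_measure_prodMk_left hT)]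
  congr 1 with s
  rw [← Measure.prod_prod]
  rfl

theorem midProd_closure_subset_etaSet {d : ℕ} {κ t r : ℝ}
    {A : Set (EuclideanSpace ℝ (Fin d))} :
    midProd (closure A) (tauSet d κ t r) ⊆ etaSet d κ t A r := by
  rintro ⟨s, y, z⟩ ⟨hy, hs, hz, h⟩
  refine ⟨hs, hz, ?_⟩
  simpa [Metric.infDist_zero_of_mem_closure hy] using h

theorem mem_tauSet_of_mem_etaSet {d : ℕ} {κ t r : ℝ} (hκ : 0 < κ)
    {A : Set (EuclideanSpace ℝ (Fin d))} {s z : ℝ} {y : EuclideanSpace ℝ (Fin d)}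
    (h : (s, y, z) ∈ etaSet d κ t A r) : (s, z) ∈ tauSet d κ t r := by
  obtain ⟨hs, hz, h⟩ := h
  simp only at hs hz h
  have hs0 : 0 < s := hs.1
  have hz0 : 0 < z := hz
  refine ⟨hs, hz, h.trans_le ?_⟩
  have : Real.exp (-(Metric.infDist y A) ^ 2 / (2 * κ * s)) ≤ 1 :=
    Real.exp_le_one_iff.mpr (div_nonpos_of_nonpos_of_nonneg (by simp [sq_nonneg]) (by positivity))
  simp only
  gcongr
  exact mul_le_of_le_one_right (by positivity) this

theorem closure_mul_tauBar_le_etaBarA {d : ℕ} {κ t r : ℝ} (lam : Measure ℝ) [SFinite lam]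
    (A : Set (EuclideanSpace ℝ (Fin d))) :
    volume (closure A) * tauBar d κ t lam r ≤ etaBarA d κ t lam A r := by
  refine (measure_midProd lam isClosed_closure.measurableSet
    (measurableSet_tauSet d κ t r)).symm.le.trans (measure_mono midProd_closure_subset_etaSet)

theorem infDist_le_of_mem_etaSet {d : ℕ} (hd : 1 ≤ d) {κ t r : ℝ} (hκ : 0 < κ) (hr : 0 < r)
    {A : Set (EuclideanSpace ℝ (Fin d))} {s z : ℝ} {y : EuclideanSpace ℝ (Fin d)}
    (h : (s, y, z) ∈ etaSet d κ t A r) {a : ℝ} (ha : 0 < a) (ha1 : a ≤ 1) :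
    Metric.infDist y A ≤
      √(κ * d / a * (t ^ (1 - a) * (2 * π * κ) ^ (-a))) * (z / r) ^ (a / d) := by
  obtain ⟨hs, hz, h⟩ := h
  simp only at hs hz h
  have hs0 : 0 < s := hs.1
  have hz0 : 0 < z := hz
  have ht : 0 < t := hs0.trans_le hs.2
  have hd0 : (0 : ℝ) < d := by exact_mod_cast hd
  have hD : 0 < 2 * π * κ := by positivity
  have key := sq_le_of_lt_gaussian_mul hd hκ hs0 hz0 hr ha h
  have e1 : s * ((z / r) ^ ((2 : ℝ) / d) / (2 * π * κ * s)) ^ a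
      = s ^ (1 - a) * (2 * π * κ) ^ (-a) * ((z / r) ^ (a / d)) ^ 2 := by
    rw [Real.div_rpow (by positivity) (by positivity), Real.mul_rpow hD.le hs0.le,
      ← Real.rpow_natCast _ 2, ← Real.rpow_mul (by positivity), ← Real.rpow_mul (by positivity),
      Real.rpow_sub hs0, Real.rpow_one, Real.rpow_neg hD.le]
    have : (2 : ℝ) / d * a = a / d * (2 : ℕ) := by push_cast; ring
    rw [this]
    field_simp
  rw [e1] at key
  have hst : s ^ (1 - a) ≤ t ^ (1 - a) := Real.rpow_le_rpow hs0.le hs.2 (by linarith)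
  refine abs_le_of_sq_le_sq' ?_ (by positivity) |>.2
  rw [mul_pow, Real.sq_sqrt (by positivity), mul_assoc (κ * d / a)]
  refine key.trans ?_
  gcongr

theorem volume_prod_infDist_le {d : ℕ} (lam : Measure ℝ) [SFinite lam]
    {A : Set (EuclideanSpace ℝ (Fin d))} {R : ℝ} (hR : 0 ≤ R)
    (hAne : A.Nonempty) (hAR : A ⊆ Metric.closedBall 0 R) {C a r ε : ℝ} (hC : 0 ≤ C)
    (hd : 1 ≤ d) (hr : 0 < r) (hε : 0 < ε) (ha : 0 < a) :
    ((volume : Measure (EuclideanSpace ℝ (Fin d))).prod lam)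
      {p | ε * r < p.2 ∧ Metric.infDist p.1 A ≤ C * (p.2 / r) ^ (a / d)}
      ≤ ENNReal.ofReal ((R / ε ^ (a / d) + C + 1) ^ d) *
          volume (Metric.closedBall (0 : EuclideanSpace ℝ (Fin d)) 1) *
        ∫⁻ z in Ioi (ε * r), ENNReal.ofReal ((z / r) ^ a) ∂lam := by
  have hd0 : (0 : ℝ) < d := by exact_mod_cast hd
  have hm : MeasurableSet {p : EuclideanSpace ℝ (Fin d) × ℝ |
      ε * r < p.2 ∧ Metric.infDist p.1 A ≤ C * (p.2 / r) ^ (a / d)} := by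
    refine (measurableSet_lt measurable_const measurable_snd).inter (measurableSet_le ?_
      (show Measurable fun p : EuclideanSpace ℝ (Fin d) × ℝ => C * (p.2 / r) ^ (a / d) by fun_prop))
    exact (Metric.continuous_infDist_pt A).measurable.comp measurable_fst
  rw [Measure.prod_apply_symm hm, ← lintegral_const_mul _ (by fun_prop),
    ← lintegral_indicator measurableSet_Ioi]
  refine lintegral_mono fun z => ?_
  by_cases hz : z ∈ Ioi (ε * r)
  · rw [indicator_of_mem hz]
    have hz' : ε * r < z := hz
    have hu : ε < z / r := (lt_div_iff₀ hr).mpr hz'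
    have hu0 : 0 < z / r := hε.trans hu
    set v := (z / r) ^ (a / d) with hv
    have hv0 : 0 < v := by positivity
    have hεv : ε ^ (a / d) ≤ v := Real.rpow_le_rpow hε.le hu.le (by positivity)
    have hsub : (fun x : EuclideanSpace ℝ (Fin d) => (x, z)) ⁻¹' {p | ε * r < p.2 ∧
        Metric.infDist p.1 A ≤ C * (p.2 / r) ^ (a / d)}
        ⊆ Metric.closedBall 0 ((R / ε ^ (a / d) + C + 1) * v) := by
      rintro y ⟨-, hy⟩
      simp only at hy
      have hlt : Metric.infDist y A < C * v + v := by
        refine lt_of_le_of_lt hy ?_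
        rw [← hv]; linarith
      obtain ⟨w, hw, hyw⟩ := (Metric.infDist_lt_iff hAne).mp hlt
      have hwR : dist w 0 ≤ R := hAR hw
      have : R ≤ R / ε ^ (a / d) * v := by
        rw [div_mul_eq_mul_div, le_div_iff₀ (by positivity)]
        gcongr
      rw [Metric.mem_closedBall]
      linarith [dist_triangle y w 0]
    refine (measure_mono hsub).trans (le_of_eq ?_)
    rw [Measure.addHaar_closedBall' _ _ (by positivity), finrank_euclideanSpace, Fintype.card_fin,
      mul_pow, ENNReal.ofReal_mul (by positivity), hv, ← Real.rpow_mul_natCast (by positivity),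
      div_mul_cancel₀ _ hd0.ne']
    ring
  · have : (fun x : EuclideanSpace ℝ (Fin d) => (x, z)) ⁻¹' {p | ε * r < p.2 ∧
        Metric.infDist p.1 A ≤ C * (p.2 / r) ^ (a / d)} = ∅ := by
      ext x
      simp only [mem_preimage, mem_ofPred_eq, mem_empty_iff_false, iff_false, not_and]
      exact fun h => (hz h).elim
    rw [this, measure_empty]
    exact zero_le

theorem exists_volume_shell_le {d : ℕ} {A : Set (EuclideanSpace ℝ (Fin d))}
    (hAbd : Bornology.IsBounded A) (hAne : A.Nonempty) {δ : ℝ≥0∞} (hδ : δ ≠ 0) :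
    ∃ ρ > (0 : ℝ), volume ({y | Metric.infDist y A ≤ ρ} \ closure A) ≤ δ := by
  have hcl : volume (closure A) ≠ ⊤ := hAbd.closure.measure_lt_top.ne
  have ht := tendsto_measure_cthickening (μ := (volume : Measure (EuclideanSpace ℝ (Fin d))))
    (s := A) ⟨1, one_pos, hAbd.cthickening.measure_lt_top.ne⟩
  have hev : ∀ᶠ ρ in 𝓝[>] (0 : ℝ),
      volume (Metric.cthickening ρ A) < volume (closure A) + δ :=
    (ht.mono_left nhdsWithin_le_nhds).eventually_lt_const (ENNReal.lt_add_right hcl hδ)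
  obtain ⟨ρ, hρ, hρ0⟩ := (hev.and self_mem_nhdsWithin).exists
  have hρ0' : 0 < ρ := hρ0
  refine ⟨ρ, hρ0', ?_⟩
  have heq : {y | Metric.infDist y A ≤ ρ} = Metric.cthickening ρ A := by
    ext y
    simp only [mem_ofPred_eq, Metric.cthickening, Metric.infDist]
    rw [ENNReal.le_ofReal_iff_toReal_le (Metric.infEDist_ne_top hAne) hρ0'.le]
  rw [heq, measure_sdiff (Metric.closure_subset_cthickening _ _)
    isClosed_closure.measurableSet.nullMeasurableSet hcl]
  exact tsub_le_iff_left.mpr hρ.le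

/-- The part of `etaBarA` coming from outside the closure of `A` is controlled by an arbitrarily
small multiple of `tauBar` and a tail integral. -/
theorem exists_etaBarA_le {d : ℕ} (hd : 1 ≤ d) {κ t : ℝ} (hκ : 0 < κ) (ht : 0 < t)
    (lam : Measure ℝ) [SFinite lam] {A : Set (EuclideanSpace ℝ (Fin d))}
    (hAbd : Bornology.IsBounded A) (hAne : A.Nonempty) {δ : ℝ≥0∞} (hδ : δ ≠ 0)
    {a : ℝ} (ha : 0 < a) (ha1 : a ≤ 1) :
    ∃ ε > (0 : ℝ), ∃ K : ℝ≥0∞, K ≠ ⊤ ∧ ∀ r > (0 : ℝ),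
      etaBarA d κ t lam A r ≤ volume (closure A) * tauBar d κ t lam r + δ * tauBar d κ t lam r +
        K * ∫⁻ z in Ioi (ε * r), ENNReal.ofReal ((z / r) ^ a) ∂lam := by
  have hd0 : (0 : ℝ) < d := by exact_mod_cast hd
  obtain ⟨ρ, hρ0, hρ⟩ := exists_volume_shell_le hAbd hAne hδ
  obtain ⟨R', hR'⟩ := hAbd.subset_closedBall (0 : EuclideanSpace ℝ (Fin d))
  set R := max R' 0
  have hR0 : 0 ≤ R := le_max_right _ _
  have hAR : A ⊆ Metric.closedBall 0 R :=
    hR'.trans (Metric.closedBall_subset_closedBall (le_max_left _ _))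
  set C := √(κ * d / a * (t ^ (1 - a) * (2 * π * κ) ^ (-a)))
  set C₁ := √(κ * d / 1 * (t ^ (1 - 1 : ℝ) * (2 * π * κ) ^ (-1 : ℝ)))
  have hC₁ : 0 < C₁ := by
    apply Real.sqrt_pos.mpr; positivity
  refine ⟨(ρ / C₁) ^ (d : ℝ), by positivity, ENNReal.ofReal t *
    (ENNReal.ofReal ((R / ((ρ / C₁) ^ (d : ℝ)) ^ (a / d) + C + 1) ^ d) *
      volume (Metric.closedBall (0 : EuclideanSpace ℝ (Fin d)) 1)), ?_, fun r hr => ?_⟩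
  · exact (ENNReal.mul_lt_top ENNReal.ofReal_lt_top (ENNReal.mul_lt_top ENNReal.ofReal_lt_top
      measure_closedBall_lt_top)).ne
  set ε := (ρ / C₁) ^ (d : ℝ) with hε
  have hε0 : 0 < ε := by positivity
  have hsub : etaSet d κ t A r ⊆ midProd (closure A) (tauSet d κ t r) ∪
      midProd ({y | Metric.infDist y A ≤ ρ} \ closure A) (tauSet d κ t r) ∪
      Ioc 0 t ×ˢ {p : EuclideanSpace ℝ (Fin d) × ℝ | ε * r < p.2 ∧
        Metric.infDist p.1 A ≤ C * (p.2 / r) ^ (a / d)} := by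
    rintro ⟨s, y, z⟩ h
    have hτ := mem_tauSet_of_mem_etaSet hκ h
    have hz0 : 0 < z := h.2.1
    by_cases hy : y ∈ closure A
    · exact Or.inl (Or.inl ⟨hy, hτ⟩)
    rcases lt_or_ge (ε * r) z with hz | hz
    · exact Or.inr ⟨h.1, hz, infDist_le_of_mem_etaSet hd hκ hr h ha ha1⟩
    · refine Or.inl (Or.inr ⟨⟨?_, hy⟩, hτ⟩)
      have h1 := infDist_le_of_mem_etaSet hd hκ hr h one_pos le_rfl
      have h2 : (z / r) ^ (1 / (d : ℝ)) ≤ ρ / C₁ := by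
        rw [one_div, Real.rpow_inv_le_iff_of_pos (by positivity) (by positivity) hd0]
        exact (div_le_iff₀ hr).mpr hz
      calc Metric.infDist y A ≤ C₁ * (z / r) ^ (1 / (d : ℝ)) := h1
        _ ≤ C₁ * (ρ / C₁) := by gcongr
        _ = ρ := by field_simp
  have hBm : MeasurableSet ({y | Metric.infDist y A ≤ ρ} \ closure A) :=
    ((isClosed_le (Metric.continuous_infDist_pt A) continuous_const).measurableSet).diff
      isClosed_closure.measurableSet
  refine (measure_mono hsub).trans ((measure_union_le _ _).trans (add_le_add
    ((measure_union_le _ _).trans (add_le_add ?_ ?_)) ?_))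
  · exact (measure_midProd lam isClosed_closure.measurableSet (measurableSet_tauSet d κ t r)).le
  · rw [measure_midProd lam hBm (measurableSet_tauSet d κ t r)]
    exact mul_le_mul_left hρ _
  · rw [Measure.prod_prod, Real.volume_Ioc, sub_zero, mul_assoc]
    exact mul_le_mul_right (volume_prod_infDist_le lam hR0 hAne hAR (Real.sqrt_nonneg _) hd hr hε0 ha) _

theorem setLIntegral_div_rpow (lam : Measure ℝ) {S : Set ℝ} (hS : MeasurableSet S)
    (hS0 : S ⊆ Ioi 0) {r : ℝ} (hr : 0 < r) (p : ℝ) :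
    ∫⁻ z in S, ENNReal.ofReal ((z / r) ^ p) ∂lam
      = ENNReal.ofReal (r ^ (-p)) * ∫⁻ z in S, ENNReal.ofReal (z ^ p) ∂lam := by
  rw [← lintegral_const_mul _ (by fun_prop)]
  refine setLIntegral_congr_fun hS fun z hz => ?_
  have hz0 : 0 < z := hS0 hz
  rw [← ENNReal.ofReal_mul (by positivity), Real.div_rpow hz0.le hr.le, Real.rpow_neg hr.le]
  ring_nf

theorem tail_le_of_moment_lt_top {lam : Measure ℝ} (hne : lam ≠ 0) (h0 : lam (Iic 0) = 0)
    {p a : ℝ} (hap : a ≤ p)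
    (hm : ∫⁻ z in Ioi (0 : ℝ), ENNReal.ofReal (z ^ p) ∂lam < ⊤) {ε : ℝ} (hε : 0 < ε)
    {δ : ℝ≥0∞} (hδ : δ ≠ 0) :
    ∀ᶠ r in atTop, ∫⁻ z in Ioi (ε * r), ENNReal.ofReal ((z / r) ^ a) ∂lam
      ≤ δ * ∫⁻ z in Ioc 0 r, ENNReal.ofReal ((z / r) ^ p) ∂lam := by
  set ν := (lam.restrict (Ioi 0)).withDensity fun z => ENNReal.ofReal (z ^ p) with hν
  have hνuniv : ν univ ≠ ⊤ := by
    rw [hν, withDensity_apply _ MeasurableSet.univ, Measure.restrict_univ]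
    exact hm.ne
  have : IsFiniteMeasure ν := ⟨hνuniv.lt_top⟩
  have hν0 : ν univ ≠ 0 := by
    rw [hν, withDensity_apply _ MeasurableSet.univ, Measure.restrict_univ]
    have hpos : 0 < ∫⁻ z in Ioi (0 : ℝ), ENNReal.ofReal (z ^ p) ∂lam := by
      rw [setLIntegral_pos_iff (by fun_prop)]
      have hsub : Ioi (0 : ℝ) ⊆ Function.support (fun z : ℝ => ENNReal.ofReal (z ^ p)) ∩ Ioi 0 :=
        fun z hz => ⟨(ENNReal.ofReal_pos.mpr (Real.rpow_pos_of_pos hz p)).ne', hz⟩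
      refine lt_of_lt_of_le ?_ (measure_mono hsub)
      rw [pos_iff_ne_zero]
      intro h
      apply hne
      rw [← Measure.measure_univ_eq_zero, ← Iic_union_Ioi (a := (0 : ℝ))]
      exact measure_union_null h0 h
    exact hpos.ne'
  have hνIoc : ∀ S : Set ℝ, MeasurableSet S →
      ν S = ∫⁻ z in S ∩ Ioi 0, ENNReal.ofReal (z ^ p) ∂lam := fun S hS => by
    rw [hν, withDensity_apply _ hS, Measure.restrict_restrict hS]
  have hlim1 : Tendsto (fun r => ν (Iic r)) atTop (𝓝 (ν univ)) := tendsto_measure_Iic_atTop ν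
  have hlim2 : Tendsto (fun r => ν (Ioi (ε * r))) atTop (𝓝 0) := by
    have h1 : Tendsto (fun r => ν univ - ν (Iic r)) atTop (𝓝 (ν univ - ν univ)) :=
      ENNReal.Tendsto.sub tendsto_const_nhds hlim1 (Or.inl hνuniv)
    rw [tsub_self] at h1
    refine (h1.comp (tendsto_id.const_mul_atTop hε)).congr fun r => ?_
    simp only [Function.comp, id]
    rw [← measure_compl measurableSet_Iic (measure_ne_top _ _), compl_Iic]
  have hl : Tendsto (fun r => ENNReal.ofReal (ε ^ (a - p)) * ν (Ioi (ε * r))) atTop (𝓝 0) := by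
    simpa using ENNReal.Tendsto.const_mul hlim2 (Or.inr ENNReal.ofReal_ne_top)
  have hr : Tendsto (fun r => δ * ν (Iic r)) atTop (𝓝 (δ * ν univ)) :=
    ENNReal.Tendsto.const_mul hlim1 (Or.inl hν0)
  filter_upwards [hl.eventually_lt hr (pos_iff_ne_zero.mpr (mul_ne_zero hδ hν0)),
    eventually_gt_atTop 0] with r hlt hr0
  have hεr : 0 < ε * r := by positivity
  have hsub : Ioi (ε * r) ⊆ Ioi 0 := Ioi_subset_Ioi hεr.le
  have hstep : ∫⁻ z in Ioi (ε * r), ENNReal.ofReal ((z / r) ^ a) ∂lam ≤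
      ENNReal.ofReal (ε ^ (a - p)) * ∫⁻ z in Ioi (ε * r), ENNReal.ofReal ((z / r) ^ p) ∂lam := by
    rw [← lintegral_const_mul _ (by fun_prop)]
    refine setLIntegral_mono' measurableSet_Ioi fun z hz => ?_
    rw [← ENNReal.ofReal_mul (by positivity)]
    apply ENNReal.ofReal_le_ofReal
    have hu : ε ≤ z / r := ((lt_div_iff₀ hr0).mpr hz).le
    have hu0 : 0 < z / r := hε.trans_le hu
    calc (z / r) ^ a = (z / r) ^ (a - p) * (z / r) ^ p := by rw [← Real.rpow_add hu0]; ring_nf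
      _ ≤ _ := by
        have := Real.rpow_le_rpow_of_nonpos hε hu (by linarith : a - p ≤ 0)
        gcongr
  refine hstep.trans ?_
  rw [setLIntegral_div_rpow lam measurableSet_Ioi hsub hr0,
    setLIntegral_div_rpow lam measurableSet_Ioc Ioc_subset_Ioi_self hr0]
  have h1 := hνIoc _ (measurableSet_Ioi (a := ε * r))
  have h2 := hνIoc _ (measurableSet_Iic (a := r))
  rw [inter_eq_left.mpr hsub] at h1
  rw [inter_comm, Ioi_inter_Iic] at h2
  rw [← h1, ← h2, mul_left_comm, mul_left_comm δ]
  gcongr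

theorem lintegral_div_rpow_le_of_doubling (lam : Measure ℝ) {x a : ℝ} (hx : 0 < x) (ha : 0 ≤ a)
    {b : ℝ≥0∞} (h : ∀ k : ℕ, lam (Ioi (2 ^ k * x)) ≤ b ^ k * lam (Ioi x)) :
    ∫⁻ z in Ioi x, ENNReal.ofReal ((z / x) ^ a) ∂lam
      ≤ (ENNReal.ofReal (2 ^ a) * ∑' k : ℕ, (ENNReal.ofReal (2 ^ a) * b) ^ k) * lam (Ioi x) := by
  have hsub : Ioi x ⊆ ⋃ k : ℕ, Ioc (2 ^ k * x) (2 ^ (k + 1) * x) := by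
    intro z hz
    have hz1 : 1 < z / x := (one_lt_div hx).mpr hz
    obtain ⟨n, hn1, hn2⟩ := exists_mem_Ioc_zpow (x := z / x) (y := (2 : ℝ)) (by positivity)
      (by norm_num)
    have hn : 0 ≤ n := by
      by_contra hcon
      have : (2 : ℝ) ^ (n + 1) ≤ 1 := zpow_le_one_of_nonpos₀ (by norm_num) (by omega)
      linarith
    lift n to ℕ using hn
    refine mem_iUnion.mpr ⟨n, ?_, ?_⟩
    · rw [← lt_div_iff₀ hx]; exact_mod_cast hn1
    · rw [← div_le_iff₀ hx]; exact_mod_cast hn2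
  calc ∫⁻ z in Ioi x, ENNReal.ofReal ((z / x) ^ a) ∂lam
      ≤ ∑' k : ℕ, ∫⁻ z in Ioc (2 ^ k * x) (2 ^ (k + 1) * x), ENNReal.ofReal ((z / x) ^ a) ∂lam :=
        (lintegral_mono_set hsub).trans (lintegral_iUnion_le _ _)
    _ ≤ ∑' k : ℕ, ENNReal.ofReal (2 ^ a) * (ENNReal.ofReal (2 ^ a) * b) ^ k * lam (Ioi x) := by
        refine ENNReal.tsum_le_tsum fun k => ?_
        calc ∫⁻ z in Ioc (2 ^ k * x) (2 ^ (k + 1) * x), ENNReal.ofReal ((z / x) ^ a) ∂lam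
            ≤ ∫⁻ z in Ioc (2 ^ k * x) (2 ^ (k + 1) * x), ENNReal.ofReal (2 ^ a) ^ (k + 1) ∂lam := by
              refine setLIntegral_mono' measurableSet_Ioc fun z hz => ?_
              rw [← ENNReal.ofReal_pow (by positivity)]
              apply ENNReal.ofReal_le_ofReal
              have hz0 : 0 < z := lt_trans (by positivity) hz.1
              have hzx : z / x ≤ 2 ^ (k + 1) := (div_le_iff₀ hx).mpr hz.2
              calc (z / x) ^ a ≤ ((2 : ℝ) ^ (k + 1)) ^ a := by gcongr
                _ = (2 ^ a) ^ (k + 1) := by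
                  rw [← Real.rpow_natCast, ← Real.rpow_natCast, ← Real.rpow_mul (by norm_num),
                    ← Real.rpow_mul (by norm_num), mul_comm]
          _ ≤ ENNReal.ofReal (2 ^ a) ^ (k + 1) * (b ^ k * lam (Ioi x)) := by
              rw [setLIntegral_const]
              gcongr
              exact (measure_mono Ioc_subset_Ioi_self).trans (h k)
          _ = _ := by rw [mul_pow]; ring
    _ = _ := by rw [ENNReal.tsum_mul_right, ENNReal.tsum_mul_left]

theorem SlowlyVarying.eventually_comp_le_mul {ℓ : ℝ → ℝ} (hℓ : SlowlyVarying ℓ) {c θ : ℝ} (hc : 0 < c)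
    (hθ : 1 < θ) : ∀ᶠ x in atTop, ℓ (c * x) ≤ θ * ℓ x := by
  filter_upwards [(hℓ.2.2 c hc).eventually_lt_const hθ, eventually_ge_atTop 1] with x hx hx1
  exact ((div_lt_iff₀ (hℓ.2.1 x hx1)).mp hx).le

theorem SlowlyVarying.eventually_mul_le_comp {ℓ : ℝ → ℝ} (hℓ : SlowlyVarying ℓ) {c θ : ℝ} (hc : 0 < c)
    (hθ : θ < 1) : ∀ᶠ x in atTop, θ * ℓ x ≤ ℓ (c * x) := by
  filter_upwards [(hℓ.2.2 c hc).eventually_const_lt hθ, eventually_ge_atTop 1] with x hx hx1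
  exact ((lt_div_iff₀ (hℓ.2.1 x hx1)).mp hx).le

section RegularlyVaryingTail

variable {lam : Measure ℝ} {ℓ : ℝ → ℝ} {p : ℝ}

theorem exists_lintegral_le_measure_Ioi (hℓ : SlowlyVarying ℓ) (hp : 0 < p)
    (htail : ∀ r ≥ (1 : ℝ), lam (Ioi r) = ENNReal.ofReal (ℓ r * r ^ (-p)))
    {a : ℝ} (ha : 0 ≤ a) (hap : a < p / 2) :
    ∃ K : ℝ≥0∞, K ≠ ⊤ ∧ ∀ᶠ x in atTop,
      ∫⁻ z in Ioi x, ENNReal.ofReal ((z / x) ^ a) ∂lam ≤ K * lam (Ioi x) := by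
  have h2 : (1 : ℝ) < 2 ^ (p / 2) := Real.one_lt_rpow (by norm_num) (by positivity)
  obtain ⟨x₀, hx₀⟩ := eventually_atTop.mp (hℓ.eventually_comp_le_mul (c := 2) (by norm_num) h2)
  set b := ENNReal.ofReal (2 ^ (-(p / 2))) with hb
  have hstep : ∀ x ≥ max x₀ 1, lam (Ioi (2 * x)) ≤ b * lam (Ioi x) := by
    intro x hx
    have hx1 : 1 ≤ x := (le_max_right _ _).trans hx
    have hx0 : 0 < x := by linarith
    rw [htail x hx1, htail (2 * x) (by linarith), hb, ← ENNReal.ofReal_mul (by positivity)]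
    apply ENNReal.ofReal_le_ofReal
    rw [Real.mul_rpow (by norm_num) hx0.le]
    have := hx₀ x ((le_max_left _ _).trans hx)
    calc ℓ (2 * x) * (2 ^ (-p) * x ^ (-p)) ≤ (2 ^ (p / 2) * ℓ x) * (2 ^ (-p) * x ^ (-p)) := by gcongr
      _ = (2 ^ (p / 2) * 2 ^ (-p)) * (ℓ x * x ^ (-p)) := by ring
      _ = _ := by rw [← Real.rpow_add (by norm_num)]; ring_nf
  refine ⟨ENNReal.ofReal (2 ^ a) * ∑' k : ℕ, (ENNReal.ofReal (2 ^ a) * b) ^ k, ?_, ?_⟩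
  rotate_left
  · filter_upwards [eventually_ge_atTop (max x₀ 1)] with x hx
    have hx1 : 1 ≤ x := (le_max_right _ _).trans hx
    have hx0 : 0 < x := by linarith
    refine lintegral_div_rpow_le_of_doubling lam hx0 ha (b := b) fun k => ?_
    induction k with
    | zero => simp
    | succ k ih =>
      have h1 : (1 : ℝ) ≤ 2 ^ k := one_le_pow₀ (by norm_num)
      have := hstep (2 ^ k * x) (by nlinarith)
      rw [← mul_assoc, ← pow_succ'] at this
      calc _ ≤ b * lam (Ioi (2 ^ k * x)) := this
        _ ≤ b * (b ^ k * lam (Ioi x)) := by gcongr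
        _ = _ := by rw [pow_succ']; ring
  · refine ENNReal.mul_ne_top ENNReal.ofReal_ne_top ?_
    rw [ENNReal.tsum_geometric]
    simp only [ne_eq, ENNReal.inv_eq_top, tsub_eq_zero_iff_le, not_le]
    rw [hb, ← ENNReal.ofReal_mul (by positivity), ← Real.rpow_add (by norm_num)]
    rw [← ENNReal.ofReal_one]
    refine (ENNReal.ofReal_lt_ofReal_iff one_pos).mpr ?_
    exact Real.rpow_lt_one_of_one_lt_of_neg (by norm_num) (by linarith)

theorem eventually_mul_le_lintegral_Ioc (hℓ : SlowlyVarying ℓ) (hp : 0 < p)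
    (htail : ∀ r ≥ (1 : ℝ), lam (Ioi r) = ENNReal.ofReal (ℓ r * r ^ (-p))) (N : ℕ) :
    ∀ᶠ r in atTop, ENNReal.ofReal (N * ((1 - 2 ^ (-p)) / 2 * ℓ r)) ≤
      ∫⁻ z in Ioc (r / 2 ^ N) r, ENNReal.ofReal (z ^ p) ∂lam := by
  have h2p : (2 : ℝ) ^ (-p) < 1 := Real.rpow_lt_one_of_one_lt_of_neg (by norm_num) (by linarith)
  have h2p0 : (0 : ℝ) < 2 ^ (-p) := by positivity
  set c := (1 - (2 : ℝ) ^ (-p)) / 2 with hc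
  have hc0 : 0 < c := by rw [hc]; linarith
  induction N with
  | zero => simp
  | succ N ih =>
    have hlow := hℓ.eventually_mul_le_comp (c := 1 / 2 ^ (N + 1)) (θ := 1 - c / 2) (by positivity)
      (by linarith)
    have hupp := hℓ.eventually_comp_le_mul (c := 1 / 2 ^ N) (θ := 1 + c / 2) (by positivity)
      (by linarith)
    filter_upwards [ih, hlow, hupp, eventually_ge_atTop (2 ^ (N + 1))] with r hr hlow hupp hr2
    have h2N : (1 : ℝ) ≤ 2 ^ (N + 1) := one_le_pow₀ (by norm_num)
    have hℓr : 0 < ℓ r := hℓ.2.1 r (h2N.trans hr2)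
    set x := 1 / 2 ^ (N + 1) * r with hx
    have hx1 : 1 ≤ x := by
      rw [hx, one_div_mul_eq_div, le_div_iff₀ (by positivity)]; linarith
    have hx0 : 0 < x := by linarith
    have h2x : 1 / 2 ^ N * r = 2 * x := by rw [hx]; field_simp; ring
    rw [h2x] at hupp
    have e1 : r / 2 ^ (N + 1) = x := by rw [hx]; ring
    have e2 : r / 2 ^ N = 2 * x := by rw [← h2x]; ring
    have hle : 2 * x ≤ r := by
      rw [← e2]; exact div_le_self (by linarith) (one_le_pow₀ (by norm_num))
    rw [e2] at hr
    rw [e1, ← Ioc_union_Ioc_eq_Ioc (show x ≤ 2 * x by linarith) hle,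
      lintegral_union measurableSet_Ioc (Ioc_disjoint_Ioc_of_le le_rfl)]
    have hann : ENNReal.ofReal (c * ℓ r) ≤
        ∫⁻ z in Ioc x (2 * x), ENNReal.ofReal (z ^ p) ∂lam := by
      have hmeas : lam (Ioc x (2 * x)) =
          ENNReal.ofReal (ℓ x * x ^ (-p)) - ENNReal.ofReal (ℓ (2 * x) * (2 * x) ^ (-p)) := by
        rw [← htail x hx1, ← htail (2 * x) (by linarith), ← measure_sdiff
          (Ioi_subset_Ioi (by linarith)) measurableSet_Ioi.nullMeasurableSet
          (by rw [htail (2 * x) (by linarith)]; exact ENNReal.ofReal_ne_top), Ioi_sdiff_Ioi]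
      have hℓ2x : 0 < ℓ (2 * x) := hℓ.2.1 _ (by linarith)
      calc ENNReal.ofReal (c * ℓ r)
          ≤ ENNReal.ofReal (x ^ p * (ℓ x * x ^ (-p) - ℓ (2 * x) * (2 * x) ^ (-p))) := by
            apply ENNReal.ofReal_le_ofReal
            have e : x ^ p * (ℓ x * x ^ (-p) - ℓ (2 * x) * (2 * x) ^ (-p))
                = ℓ x - 2 ^ (-p) * ℓ (2 * x) := by
              rw [Real.mul_rpow (by norm_num) hx0.le, Real.rpow_neg hx0.le]
              field_simp
            rw [e]
            have : 2 ^ (-p) * ℓ (2 * x) ≤ 2 ^ (-p) * ((1 + c / 2) * ℓ r) := by gcongr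
            have h3 : (2 : ℝ) ^ (-p) = 1 - 2 * c := by rw [hc]; ring
            rw [h3] at this ⊢
            have : 0 < c * c * ℓ r := by positivity
            nlinarith
        _ = ENNReal.ofReal (x ^ p) * lam (Ioc x (2 * x)) := by
            rw [hmeas, ENNReal.ofReal_mul (by positivity), ENNReal.ofReal_sub _ (by positivity)]
        _ = ∫⁻ z in Ioc x (2 * x), ENNReal.ofReal (x ^ p) ∂lam := by rw [setLIntegral_const]
        _ ≤ _ := setLIntegral_mono' measurableSet_Ioc fun z hz => by
            have := hz.1.le
            gcongr
    have hsplit : ENNReal.ofReal ((N + 1 : ℕ) * (c * ℓ r)) =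
        ENNReal.ofReal (c * ℓ r) + ENNReal.ofReal (N * (c * ℓ r)) := by
      rw [← ENNReal.ofReal_add (by positivity) (by positivity)]
      push_cast
      ring_nf
    rw [hsplit]
    exact add_le_add hann hr

theorem tail_le_of_slowlyVarying (hℓ : SlowlyVarying ℓ) (hp : 0 < p)
    (htail : ∀ r ≥ (1 : ℝ), lam (Ioi r) = ENNReal.ofReal (ℓ r * r ^ (-p)))
    {a : ℝ} (ha : 0 ≤ a) (hap : a < p / 2) {ε : ℝ} (hε : 0 < ε)
    {δ : ℝ≥0∞} (hδ : δ ≠ 0) :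
    ∀ᶠ r in atTop, ∫⁻ z in Ioi (ε * r), ENNReal.ofReal ((z / r) ^ a) ∂lam
      ≤ δ * ∫⁻ z in Ioc 0 r, ENNReal.ofReal ((z / r) ^ p) ∂lam := by
  obtain ⟨K, hK, hKx⟩ := exists_lintegral_le_measure_Ioi hℓ hp htail ha hap
  have h2p : (2 : ℝ) ^ (-p) < 1 := Real.rpow_lt_one_of_one_lt_of_neg (by norm_num) (by linarith)
  set c := (1 - (2 : ℝ) ^ (-p)) / 2 with hc
  have hc0 : 0 < c := by rw [hc]; linarith
  obtain ⟨N, hN⟩ := ENNReal.exists_nat_mul_gt (a := δ * ENNReal.ofReal c)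
    (b := ENNReal.ofReal (ε ^ a) * K * ENNReal.ofReal (2 * ε ^ (-p)))
    (mul_ne_zero hδ (ENNReal.ofReal_pos.mpr hc0).ne')
    (ENNReal.mul_ne_top (ENNReal.mul_ne_top ENNReal.ofReal_ne_top hK) ENNReal.ofReal_ne_top)
  have hεt : Tendsto (fun r : ℝ => ε * r) atTop atTop := tendsto_id.const_mul_atTop hε
  filter_upwards [hεt.eventually hKx, hεt.eventually (eventually_ge_atTop 1),
    eventually_ge_atTop 1, hℓ.eventually_comp_le_mul hε (one_lt_two),
    eventually_mul_le_lintegral_Ioc hℓ hp htail N] with r hKr hεr hr1 hℓr hNr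
  have hr0 : 0 < r := by linarith
  have hℓ0 : 0 < ℓ r := hℓ.2.1 r hr1
  have hεr0 : 0 < ε * r := by positivity
  calc ∫⁻ z in Ioi (ε * r), ENNReal.ofReal ((z / r) ^ a) ∂lam
      = ENNReal.ofReal (ε ^ a) *
          ∫⁻ z in Ioi (ε * r), ENNReal.ofReal ((z / (ε * r)) ^ a) ∂lam := by
        rw [← lintegral_const_mul _ (by fun_prop)]
        refine setLIntegral_congr_fun measurableSet_Ioi fun z hz => ?_
        have hz0 : 0 < z := hεr0.trans hz
        rw [← ENNReal.ofReal_mul (by positivity), ← Real.mul_rpow hε.le (by positivity)]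
        congr 2
        field_simp
    _ ≤ ENNReal.ofReal (ε ^ a) * (K * ENNReal.ofReal (2 * ε ^ (-p) * (ℓ r * r ^ (-p)))) := by
        gcongr
        refine hKr.trans ?_
        gcongr
        rw [htail _ hεr]
        apply ENNReal.ofReal_le_ofReal
        rw [Real.mul_rpow hε.le hr0.le]
        calc ℓ (ε * r) * (ε ^ (-p) * r ^ (-p)) ≤ (2 * ℓ r) * (ε ^ (-p) * r ^ (-p)) := by gcongr
          _ = _ := by ring
    _ = (ENNReal.ofReal (ε ^ a) * K * ENNReal.ofReal (2 * ε ^ (-p))) *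
          ENNReal.ofReal (ℓ r * r ^ (-p)) := by
        rw [ENNReal.ofReal_mul (show 0 ≤ 2 * ε ^ (-p) by positivity)]; ring
    _ ≤ (N * (δ * ENNReal.ofReal c)) * ENNReal.ofReal (ℓ r * r ^ (-p)) := by gcongr
    _ = δ * (ENNReal.ofReal (r ^ (-p)) * ENNReal.ofReal (N * (c * ℓ r))) := by
        rw [ENNReal.ofReal_mul hℓ0.le, ENNReal.ofReal_mul (Nat.cast_nonneg N),
          ENNReal.ofReal_mul hc0.le, ENNReal.ofReal_natCast]
        ring
    _ ≤ δ * (ENNReal.ofReal (r ^ (-p)) * ∫⁻ z in Ioc 0 r, ENNReal.ofReal (z ^ p) ∂lam) := by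
        gcongr
        exact hNr.trans (lintegral_mono_set (Ioc_subset_Ioc_left (by positivity)))
    _ = _ := by rw [setLIntegral_div_rpow lam measurableSet_Ioc Ioc_subset_Ioi_self hr0]

end RegularlyVaryingTail

theorem eventually_lintegral_Ioc_pos {lam : Measure ℝ} (hne : lam ≠ 0) (h0 : lam (Iic 0) = 0)
    (p : ℝ) : ∀ᶠ r in atTop, 0 < ∫⁻ z in Ioc 0 r, ENNReal.ofReal ((z / r) ^ p) ∂lam := by
  have hpos : 0 < lam univ := by
    rw [pos_iff_ne_zero]; simpa using hne
  filter_upwards [(tendsto_measure_Iic_atTop lam).eventually_const_lt hpos,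
    eventually_gt_atTop 0] with r hr hr0
  rw [setLIntegral_pos_iff (by fun_prop)]
  have hsub : Ioc (0 : ℝ) r ⊆
      Function.support (fun z : ℝ => ENNReal.ofReal ((z / r) ^ p)) ∩ Ioc 0 r :=
    fun z hz => ⟨(ENNReal.ofReal_pos.mpr (Real.rpow_pos_of_pos (div_pos hz.1 hr0) p)).ne', hz⟩
  refine lt_of_lt_of_le ?_ (measure_mono hsub)
  rw [pos_iff_ne_zero]
  intro h
  refine hr.ne' ?_
  rw [← Iic_union_Ioc_eq_Iic hr0.le]
  exact measure_union_null h0 h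

/-- Lemma 3.6 (i): under Condition (F) and the log-moment condition, for a bounded
Borel set `A` with `|Ā| > 0`, if `m_{2/d}(λ) < ∞` or `λ̄(r) = ℓ(r) r^{-2/d}` with `ℓ`
slowly varying and `∫_1^∞ ℓ(u)/u du = ∞`, then `η̄_A(r) ~ |Ā| τ̄(r)` as `r → ∞`. -/
theorem stmt_15 (d : ℕ) (hd : 1 ≤ d) (κ t : ℝ) (hκ : 0 < κ) (ht : 0 < t)
    (lam : Measure ℝ) (hlam : IsLevyMeasure lam) (hF : ConditionF d lam)
    (hlog : ∫⁻ z in Set.Ioi (1 : ℝ),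
        ENNReal.ofReal (Real.log z ^ ((d : ℝ) / 2)) ∂lam < ⊤)
    (A : Set (EuclideanSpace ℝ (Fin d))) (hA : MeasurableSet A)
    (hAbd : Bornology.IsBounded A) (hApos : 0 < volume (closure A))
    (halt : (∫⁻ z in Set.Ioi (0 : ℝ), ENNReal.ofReal (z ^ ((2 : ℝ) / d)) ∂lam < ⊤) ∨
      (∃ ℓ : ℝ → ℝ, SlowlyVarying ℓ ∧
        (∀ r ≥ (1 : ℝ), (lam (Set.Ioi r)).toReal = ℓ r * r ^ (-((2 : ℝ) / d))) ∧
        Tendsto (fun r : ℝ => ∫ u in Set.Ioc (1 : ℝ) r, ℓ u / u) atTop atTop)) :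
    Tendsto (fun r : ℝ =>
        (etaBarA d κ t lam A r).toReal /
          ((volume (closure A)).toReal * (tauBar d κ t lam r).toReal))
      atTop (𝓝 1) := by
  have hd0 : (0 : ℝ) < d := by exact_mod_cast hd
  have hsf := hlam.sigmaFinite
  have hAne : A.Nonempty := by
    rw [nonempty_iff_ne_empty]
    rintro rfl
    simp at hApos
  set p : ℝ := 2 / d with hp
  have hp0 : 0 < p := by positivity
  have hp2 : p ≤ 2 := by
    rw [hp, div_le_iff₀ hd0]
    have : (1 : ℝ) ≤ d := by exact_mod_cast hd
    linarith
  have htail : ∀ ε > (0 : ℝ), ∀ δ : ℝ≥0∞, δ ≠ 0 →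
      ∀ᶠ r in atTop, ∫⁻ z in Ioi (ε * r), ENNReal.ofReal ((z / r) ^ (p / 4)) ∂lam
        ≤ δ * ∫⁻ z in Ioc 0 r, ENNReal.ofReal ((z / r) ^ p) ∂lam := by
    intro ε hε δ hδ
    rcases halt with hm | ⟨ℓ, hℓ, hℓr, -⟩
    · exact tail_le_of_moment_lt_top hlam.1 hlam.2.1 (by linarith) hm hε hδ
    · refine tail_le_of_slowlyVarying hℓ hp0 (fun r hr => ?_) (by positivity) (by linarith) hε hδ
      rw [← hℓr r hr, ENNReal.ofReal_toReal]
      exact ((measure_mono Ioi_subset_Ici_self).trans_lt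
        (hlam.measure_Ici_lt_top (by linarith : (0 : ℝ) < r))).ne
  set V := volume (closure A)
  have hV : V ≠ ⊤ := hAbd.closure.measure_lt_top.ne
  have hV0 : 0 < V.toReal := ENNReal.toReal_pos hApos.ne' hV
  set c := ENNReal.ofReal (min t (1 / (2 * π * κ))) with hc
  have hc0 : c ≠ 0 := (ENNReal.ofReal_pos.mpr (by positivity)).ne'
  have hτpos : ∀ᶠ r in atTop, 0 < (tauBar d κ t lam r).toReal := by
    filter_upwards [eventually_lintegral_Ioc_pos hlam.1 hlam.2.1 p, eventually_gt_atTop 0]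
      with r hr hr0
    refine ENNReal.toReal_pos ?_ (tauBar_lt_top hd hκ hr0 hlam hF).ne
    exact ((ENNReal.mul_pos hc0 hr.ne').trans_le (le_tauBar hd hκ hr0 lam)).ne'
  have hupper : ∀ δ : ℝ≥0∞, δ ≠ 0 → ∀ᶠ r in atTop,
      etaBarA d κ t lam A r ≤ (V + δ + δ) * tauBar d κ t lam r := by
    intro δ hδ
    obtain ⟨ε, hε, K, hK, hη⟩ := exists_etaBarA_le hd hκ ht lam hAbd hAne hδ
      (show 0 < p / 4 by positivity) (by linarith)
    have hK1 : K + 1 ≠ ⊤ := by simp [hK]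
    filter_upwards [htail ε hε (δ * c / (K + 1))
      (ENNReal.div_pos (mul_ne_zero hδ hc0) hK1).ne', eventually_gt_atTop 0] with r hr hr0
    refine (hη r hr0).trans ?_
    rw [add_mul, add_mul]
    refine add_le_add le_rfl ?_
    set M := ∫⁻ z in Ioc 0 r, ENNReal.ofReal ((z / r) ^ p) ∂lam
    calc K * ∫⁻ z in Ioi (ε * r), ENNReal.ofReal ((z / r) ^ (p / 4)) ∂lam
        ≤ (K + 1) * (δ * c / (K + 1) * M) := by gcongr; exact le_self_add
      _ = δ * (c * M) := by
          rw [← mul_assoc, ENNReal.mul_div_cancel (by simp) hK1, mul_assoc]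
      _ ≤ δ * tauBar d κ t lam r := by
          gcongr
          exact le_tauBar hd hκ hr0 lam
  rw [tendsto_order]
  constructor
  · intro b hb
    filter_upwards [hτpos, hupper 1 one_ne_zero, eventually_gt_atTop 0] with r hτ hfin hr0
    have hτt := (tauBar_lt_top (t := t) hd hκ hr0 hlam hF).ne
    refine hb.trans_le ?_
    rw [le_div_iff₀ (by positivity), one_mul, ← ENNReal.toReal_mul]
    refine ENNReal.toReal_mono ?_ (closure_mul_tauBar_le_etaBarA lam A)
    exact ne_top_of_le_ne_top (ENNReal.mul_ne_top (by simp [hV]) hτt) hfin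
  · intro b hb
    set e := V.toReal * (b - 1) / 4 with he
    have hb1 : 0 < b - 1 := by linarith
    have he0 : 0 < e := by positivity
    filter_upwards [hτpos, hupper (ENNReal.ofReal e) (ENNReal.ofReal_pos.mpr he0).ne',
      eventually_gt_atTop 0] with r hτ hle hr0
    have hτt := (tauBar_lt_top (t := t) hd hκ hr0 hlam hF).ne
    have hle' := ENNReal.toReal_mono (ENNReal.mul_ne_top (by simp [hV]) hτt) hle
    rw [ENNReal.toReal_mul, ENNReal.toReal_add (by simp [hV]) (by simp),
      ENNReal.toReal_add hV (by simp), ENNReal.toReal_ofReal he0.le] at hle'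
    rw [div_lt_iff₀ (by positivity)]
    refine hle'.trans_lt ?_
    rw [← mul_assoc]
    refine mul_lt_mul_of_pos_right ?_ hτ
    have : 0 < V.toReal * (b - 1) := by positivity
    nlinarith
end
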